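/- arXiv:1906.09496 — 2 statements merged into one kernel-verified Lean document; each statement's English description precedes it below -/
import Mathlib

section
/- Let R be a commutative ring and let A and B be commutative R-algebras. Then there is an R-linear isomorphism Ω[(A × B)⁄R] ≃ Ω[A⁄R] × Ω[B⁄R] between the module of Kähler differentials of the product algebra A × B over R and the product of the modules of Kähler differentials of A and of B over R, induced by the two projection algebra homomorphisms A × B → A and A × B → B. -/
open KaehlerDifferential

theorem derivation_idem_aux {R S M : Type*} [CommRing R] [CommRing S] [Algebra R S]
    [AddCommGroup M] [Module R M] [Module S M] (d : Derivation R S M) (e : S)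
    (he : e * e = e) : d e = 0 := by
  have h1 : d e = e • d e + e • d e := by
    conv_lhs => rw [← he, d.leibniz]
  have h2 : e • d e = e • d e + e • d e := by
    conv_lhs => rw [h1, smul_add, smul_smul, he]
  have h3 : e • d e = 0 := by simpa using h2
  rw [h1, h3, add_zero]

theorem kaehler_ker_aux {R S A : Type*} [CommRing R] [CommRing S] [CommRing A]
    [Algebra R S] [Algebra R A] [Algebra S A] [IsScalarTower R S A]
    (hs : Function.Surjective (algebraMap S A)) (e e' : S) (he' : e' * e' = e')
    (hee : e * e' = 0) (hk : ∀ s : S, algebraMap S A s = 0 → s = e' * s)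
    (w : Ω[S⁄R]) (hw : KaehlerDifferential.map R R S A w = 0) : e • w = 0 := by
  have hm : w ∈ LinearMap.ker (KaehlerDifferential.map R R S A) := hw
  rw [KaehlerDifferential.ker_map_of_surjective R S A hs] at hm
  obtain ⟨x, hx, rfl⟩ := hm
  obtain ⟨σ, hσ⟩ := hs.hasRightInverse
  have hx1 : Finsupp.mapRange.linearMap (Algebra.linearMap S A)
      (Finsupp.mapDomain (algebraMap S A) x) = 0 := hx
  have hd : ∀ s : S, algebraMap S A s = 0 → e • D R S s = 0 := by
    intro s h
    rw [hk s h, Derivation.leibniz, derivation_idem_aux (D R S) e' he', smul_zero, add_zero,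
      smul_smul, hee, zero_smul]
  have hd' : ∀ s : S, e • D R S s = e • D R S (σ (algebraMap S A s)) := by
    intro s
    rw [← sub_eq_zero, ← smul_sub, ← map_sub]
    exact hd _ (by rw [map_sub, hσ, sub_self])
  have hy : ∀ a, e * Finsupp.mapDomain (algebraMap S A) x a = 0 := by
    intro a
    have h : algebraMap S A (Finsupp.mapDomain (algebraMap S A) x a) = 0 :=
      DFunLike.congr_fun hx1 a
    rw [hk _ h, ← mul_assoc, hee, zero_mul]
  have h1 : e • Finsupp.linearCombination S (D R S) x =
      e • Finsupp.linearCombination S (fun a => D R S (σ a))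
        (Finsupp.mapDomain (algebraMap S A) x) := by
    rw [Finsupp.linearCombination_mapDomain, Finsupp.linearCombination_apply,
      Finsupp.linearCombination_apply, Finsupp.smul_sum, Finsupp.smul_sum]
    refine Finsupp.sum_congr fun s _ => ?_
    rw [smul_comm, hd' s, smul_comm]
    rfl
  rw [h1, Finsupp.linearCombination_apply, Finsupp.smul_sum]
  refine Finset.sum_eq_zero fun a _ => ?_
  change e • (_ • _) = _
  rw [smul_smul, hy, zero_smul]

/-- The module of Kähler differentials of a product of commutative `R`-algebras is the
product of the modules of Kähler differentials, via an `R`-linear isomorphism induced by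
the projection algebra homomorphisms (it carries the universal derivation of `A × B` to
the pair of universal derivations of `A` and of `B`). -/
theorem kaehlerDifferential_prod (R A B : Type*) [CommRing R] [CommRing A] [CommRing B]
    [Algebra R A] [Algebra R B] :
    ∃ e : Ω[(A × B)⁄R] ≃ₗ[R] Ω[A⁄R] × Ω[B⁄R],
      ∀ p : A × B,
        e (KaehlerDifferential.D R (A × B) p) =
          (KaehlerDifferential.D R A p.1, KaehlerDifferential.D R B p.2) := by
  let : Algebra (A × B) A := (RingHom.fst A B).toAlgebra
  let : Algebra (A × B) B := (RingHom.snd A B).toAlgebra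
  have : IsScalarTower R (A × B) A := IsScalarTower.of_algebraMap_eq fun _ => rfl
  have : IsScalarTower R (A × B) B := IsScalarTower.of_algebraMap_eq fun _ => rfl
  have sA : Function.Surjective (algebraMap (A × B) A) := fun a => ⟨(a, 0), rfl⟩
  have sB : Function.Surjective (algebraMap (A × B) B) := fun a => ⟨(0, a), rfl⟩
  let f := KaehlerDifferential.map R R (A × B) A
  let g := KaehlerDifferential.map R R (A × B) B
  have a1 : ∀ x : Ω[A⁄R], ((1, 0) : A × B) • x = x := fun x => by
    rw [← algebraMap_smul A]; exact one_smul A x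
  have a2 : ∀ x : Ω[A⁄R], ((0, 1) : A × B) • x = 0 := fun x => by
    rw [← algebraMap_smul A]; exact zero_smul A x
  have b1 : ∀ x : Ω[B⁄R], ((1, 0) : A × B) • x = 0 := fun x => by
    rw [← algebraMap_smul B]; exact zero_smul B x
  have b2 : ∀ x : Ω[B⁄R], ((0, 1) : A × B) • x = x := fun x => by
    rw [← algebraMap_smul B]; exact one_smul B x
  let F : Ω[(A × B)⁄R] →ₗ[R] Ω[A⁄R] × Ω[B⁄R] :=
    (f.restrictScalars R).prod (g.restrictScalars R)
  have hF : Function.Bijective F := by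
    constructor
    · rw [injective_iff_map_eq_zero]
      intro w hw
      have hf : f w = 0 := congrArg Prod.fst hw
      have hg : g w = 0 := congrArg Prod.snd hw
      have h1 := kaehler_ker_aux sA ((1, 0) : A × B) (0, 1) (by simp) (by ext <;> simp)
        (fun s hs => Prod.ext (by simpa using (show s.1 = 0 from hs)) (by simp)) w hf
      have h2 := kaehler_ker_aux sB ((0, 1) : A × B) (1, 0) (by simp) (by ext <;> simp)
        (fun s hs => Prod.ext (by simp) (by simpa using (show s.2 = 0 from hs))) w hg
      have h3 : (1 : A × B) = (1, 0) + (0, 1) := by ext <;> simp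
      rw [← one_smul (A × B) w, h3, add_smul, h1, h2, add_zero]
    · rintro ⟨x, y⟩
      obtain ⟨u, hu⟩ := KaehlerDifferential.map_surjective_of_surjective R R (A × B) A sA x
      obtain ⟨v, hv⟩ := KaehlerDifferential.map_surjective_of_surjective R R (A × B) B sB y
      refine ⟨((1, 0) : A × B) • u + ((0, 1) : A × B) • v, Prod.ext ?_ ?_⟩
      · change f _ = x
        rw [map_add, map_smul, map_smul, a1, a2, add_zero]; exact hu
      · change g _ = y
        rw [map_add, map_smul, map_smul, b1, b2, zero_add]; exact hv
  refine ⟨LinearEquiv.ofBijective F hF, fun p => Prod.ext ?_ ?_⟩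
  · exact KaehlerDifferential.map_D R R (A × B) A p
  · exact KaehlerDifferential.map_D R R (A × B) B p
end

section
/- Let k be a field and let A and B be commutative k-algebras. Regard A as a module over the enveloping algebra A ⊗[k] A via the multiplication map A ⊗[k] A → A, and similarly for B and for A × B over (A × B) ⊗[k] (A × B). Then for every natural number n there is an isomorphism of abelian groups Ext^n_{(A × B) ⊗[k] (A × B)}(A × B, A × B) ≅ Ext^n_{A ⊗[k] A}(A, A) × Ext^n_{B ⊗[k] B}(B, B); that is, the Hochschild cohomology of a product of commutative algebras is the product of their Hochschild cohomologies. -/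
open CategoryTheory TensorProduct

/-- `A`, viewed as a module over its enveloping algebra `A ⊗[k] A` via the
multiplication map `A ⊗[k] A → A`, as an object of `ModuleCat (A ⊗[k] A)`. -/
noncomputable def envModule (k : Type) [Field k] (A : Type) [CommRing A] [Algebra k A] :
    ModuleCat (A ⊗[k] A) :=
  letI : Module (A ⊗[k] A) A := ((Algebra.TensorProduct.lmul' k (S := A)).toRingHom).toModule
  ModuleCat.of (A ⊗[k] A) A

/-- The `n`-th Hochschild cohomology of a commutative `k`-algebra `A`:
`HH^n(A) = Ext^n_{A ⊗[k] A}(A, A)`. -/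
noncomputable def HH (k : Type) [Field k] (A : Type) [CommRing A] [Algebra k A] (n : ℕ) :
    Type :=
  ((Ext (A ⊗[k] A) (ModuleCat (A ⊗[k] A)) n).obj (Opposite.op (envModule k A))).obj
    (envModule k A)

noncomputable instance (k : Type) [Field k] (A : Type) [CommRing A] [Algebra k A] (n : ℕ) :
    AddCommGroup (HH k A n) :=
  inferInstanceAs (AddCommGroup (((Ext (A ⊗[k] A) (ModuleCat (A ⊗[k] A)) n).obj
    (Opposite.op (envModule k A))).obj (envModule k A)))

open Limits

namespace HHProd

universe u v

/-- Left derived functors are additive. -/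
lemma leftDerived_additive {C D : Type*} [Category* C] [Category* D] [Abelian C] [Abelian D]
    [HasProjectiveResolutions C] (F : C ⥤ D) [F.Additive] (n : ℕ) :
    (F.leftDerived n).Additive where
  map_add {X Y f g} := by
    let P := projectiveResolution X
    let Q := projectiveResolution Y
    rw [F.leftDerived_map_eq n f (ProjectiveResolution.lift f P Q)
        (ProjectiveResolution.lift_commutes _ _ _),
      F.leftDerived_map_eq n g (ProjectiveResolution.lift g P Q)
        (ProjectiveResolution.lift_commutes _ _ _),
      F.leftDerived_map_eq n (f + g)
        (ProjectiveResolution.lift f P Q + ProjectiveResolution.lift g P Q)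
        (by simp [Preadditive.add_comp, Functor.map_add])]
    rw [Functor.map_add, Preadditive.add_comp, Preadditive.comp_add]

/-- `Ext` is additive in the first variable. -/
lemma ext_biprod {R : Type} [CommRing R] (n : ℕ) {X₁ X₂ M : ModuleCat.{0} R} (Z : ModuleCat.{0} R)
    (i₁ : X₁ ⟶ M) (i₂ : X₂ ⟶ M) (p₁ : M ⟶ X₁) (p₂ : M ⟶ X₂)
    (h₁₁ : i₁ ≫ p₁ = 𝟙 _) (h₂₂ : i₂ ≫ p₂ = 𝟙 _) (h₁₂ : i₁ ≫ p₂ = 0) (h₂₁ : i₂ ≫ p₁ = 0)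
    (hs : p₁ ≫ i₁ + p₂ ≫ i₂ = 𝟙 M) :
    Nonempty (((Ext R (ModuleCat R) n).obj (Opposite.op M)).obj Z ≃+
      ((Ext R (ModuleCat R) n).obj (Opposite.op X₁)).obj Z ×
      ((Ext R (ModuleCat R) n).obj (Opposite.op X₂)).obj Z) := by
  have := leftDerived_additive (((linearYoneda R (ModuleCat R)).obj Z).rightOp) n
  let G : (ModuleCat R)ᵒᵖ ⥤ ModuleCat R :=
    (((linearYoneda R (ModuleCat R)).obj Z).rightOp.leftDerived n).leftOp
  have hG : G.Additive := inferInstanceAs (Functor.Additive (Functor.leftOp _))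
  change Nonempty (G.obj (Opposite.op M) ≃+ G.obj (Opposite.op X₁) × G.obj (Opposite.op X₂))
  have k₁₁ : G.map p₁.op ≫ G.map i₁.op = 𝟙 _ := by
    rw [← G.map_comp, ← op_comp, h₁₁, op_id, G.map_id]
  have k₂₂ : G.map p₂.op ≫ G.map i₂.op = 𝟙 _ := by
    rw [← G.map_comp, ← op_comp, h₂₂, op_id, G.map_id]
  have k₁₂ : G.map p₂.op ≫ G.map i₁.op = 0 := by
    rw [← G.map_comp, ← op_comp, h₁₂, op_zero, G.map_zero]
  have k₂₁ : G.map p₁.op ≫ G.map i₂.op = 0 := by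
    rw [← G.map_comp, ← op_comp, h₂₁, op_zero, G.map_zero]
  have ks : G.map i₁.op ≫ G.map p₁.op + G.map i₂.op ≫ G.map p₂.op = 𝟙 _ := by
    rw [← G.map_comp, ← G.map_comp, ← op_comp, ← op_comp, ← G.map_add, ← op_add, hs, op_id,
      G.map_id]
  refine ⟨{ toFun := fun x => (G.map i₁.op x, G.map i₂.op x)
            invFun := fun y => G.map p₁.op y.1 + G.map p₂.op y.2
            left_inv := fun x => ?_
            right_inv := fun y => ?_
            map_add' := fun x y => by simp }⟩
  · exact congr($ks x)
  · have a := congr($k₁₁ y.1)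
    have b := congr($k₂₂ y.2)
    have c := congr($k₁₂ y.2)
    have d := congr($k₂₁ y.1)
    simp only [ModuleCat.comp_apply, ModuleCat.id_apply] at a b c d
    ext
    · simp [a, c]
    · simp [b, d]

/-- Comparison of `Ext` along an exact functor preserving projectives, with values in an object
which represents the appropriate functor. -/
lemma ext_comparison {R S : Type} [CommRing R] [CommRing S]
    (F : ModuleCat.{0} S ⥤ ModuleCat.{0} R) [F.Additive] [F.PreservesHomology]
    [F.PreservesProjectiveObjects]
    (X Y : ModuleCat.{0} S) (Z : ModuleCat.{0} R) (i : F.obj Y ⟶ Z)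
    (hi : ∀ P : ModuleCat.{0} S, Function.Bijective (fun p : P ⟶ Y => F.map p ≫ i)) (n : ℕ) :
    Nonempty (((Ext R (ModuleCat R) n).obj (Opposite.op (F.obj X))).obj Z ≃+
      ((Ext S (ModuleCat S) n).obj (Opposite.op X)).obj Y) := by
  let P := projectiveResolution X
  let Q := F.mapProjectiveResolution P
  let K := P.complex.linearYonedaObj S Y
  let L := Q.complex.linearYonedaObj R Z
  let K' := ((forget₂ (ModuleCat S) Ab).mapHomologicalComplex _).obj K
  let L' := ((forget₂ (ModuleCat R) Ab).mapHomologicalComplex _).obj L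
  let e : ∀ P : ModuleCat.{0} S, (P ⟶ Y) ≃+ (F.obj P ⟶ Z) := fun P =>
    AddEquiv.ofBijective (AddMonoidHom.mk' (fun p : P ⟶ Y => F.map p ≫ i)
      (by intro a b; simp [Functor.map_add, Preadditive.add_comp])) (hi P)
  let φ : K' ≅ L' := HomologicalComplex.Hom.isoOfComponents
    (fun m => AddEquiv.toAddCommGrpIso (X := K'.X m) (Y := L'.X m) (e (P.complex.X m))) (by
      intro a b _
      ext x
      change F.map (P.complex.d b a) ≫ (F.map x ≫ i) = F.map (P.complex.d b a ≫ x) ≫ i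
      exact (Category.assoc _ _ _).symm.trans
        congr($((F.map_comp (P.complex.d b a) x).symm) ≫ i))
  let ψ : (forget₂ (ModuleCat S) Ab).obj (K.homology n) ≅
      (forget₂ (ModuleCat R) Ab).obj (L.homology n) :=
    ((K.sc n).mapHomologyIso (forget₂ (ModuleCat S) Ab)).symm ≪≫
      HomologicalComplex.homologyMapIso φ n ≪≫
      ((L.sc n).mapHomologyIso (forget₂ (ModuleCat R) Ab))
  exact ⟨((Q.isoExt (R := R) n Z).toLinearEquiv.toAddEquiv.trans
    ψ.symm.addCommGroupIsoToAddEquiv).trans (P.isoExt (R := S) n Y).toLinearEquiv.symm.toAddEquiv⟩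

variable {R S : Type} [CommRing R] [CommRing S] (f : R →+* S) (j : S →+ R)

lemma projective_compHom (hj1 : ∀ r s, j (f r * s) = r * j s) (hj2 : ∀ s, f (j s) = s)
    (P : Type) [AddCommGroup P] [Module S P] (h : Module.Projective S P) :
    @Module.Projective R _ P _ (Module.compHom P f) := by
  let _ : Module R P := Module.compHom P f
  obtain ⟨⟨s, hs⟩⟩ := h
  refine ⟨⟨{ toFun := fun p => Finsupp.mapRange j (map_zero j) (s p)
             map_add' := fun p q => ?_
             map_smul' := fun r p => ?_ }, fun p => ?_⟩⟩
  · ext x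
    simp
  · ext x
    have : s (r • p) = f r • s p := s.map_smul (f r) p
    simp [this, hj1]
  · refine Eq.trans ?_ (hs p)
    simp only [LinearMap.coe_mk, AddHom.coe_mk, Finsupp.linearCombination_apply]
    rw [Finsupp.sum_mapRange_index (by simp)]
    refine Finsupp.sum_congr fun x _ => ?_
    change f (j (s p x)) • x = s p x • x
    rw [hj2]

lemma preservesProjective (hj1 : ∀ r s, j (f r * s) = r * j s) (hj2 : ∀ s, f (j s) = s) :
    (ModuleCat.restrictScalars.{0} f).PreservesProjectiveObjects where
  projective_obj {P} hP := by
    have h : Module.Projective S P := P.projective_of_module_projective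
    have h' := projective_compHom f j hj1 hj2 P h
    exact @ModuleCat.projective_of_categoryTheory_projective R _
      ((ModuleCat.restrictScalars f).obj P) h'

lemma ext_restrict (hj1 : ∀ r s, j (f r * s) = r * j s) (hj2 : ∀ s, f (j s) = s)
    (X Y : ModuleCat.{0} S) (Z : ModuleCat.{0} R) (i : (ModuleCat.restrictScalars f).obj Y ⟶ Z)
    (hi : Function.Injective i) (hi2 : ∀ z : Z, ∃ y : Y, i y = j 1 • z) (n : ℕ) :
    Nonempty (((Ext R (ModuleCat R) n).obj
        (Opposite.op ((ModuleCat.restrictScalars f).obj X))).obj Z ≃+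
      ((Ext S (ModuleCat S) n).obj (Opposite.op X)).obj Y) := by
  have := preservesProjective f j hj1 hj2
  refine ext_comparison (ModuleCat.restrictScalars f) X Y Z i (fun P => ⟨?_, ?_⟩) n
  · intro p q hpq
    ext x
    exact hi congr($hpq x)
  · intro φ
    have key : ∀ x : P, ∃ y : Y, i y = φ x := by
      intro x
      obtain ⟨y, hy⟩ := hi2 (φ x)
      refine ⟨y, hy.trans ?_⟩
      refine (φ.hom.map_smul (j 1) x).symm.trans (congrArg φ ?_)
      change f (j 1) • (x : P) = x
      rw [hj2, one_smul]
    choose y hy using key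
    refine ⟨ModuleCat.ofHom ⟨⟨y, ?_⟩, ?_⟩, ?_⟩
    · intro a b
      apply hi
      refine (hy _).trans ?_
      refine Eq.trans ?_ (map_add i.hom (y a) (y b)).symm
      exact (map_add φ.hom a b).trans congr($((hy a).symm) + $((hy b).symm))
    · intro s a
      apply hi
      refine (hy _).trans ?_
      obtain ⟨r, rfl⟩ : ∃ r, f r = s := ⟨j s, hj2 s⟩
      refine Eq.trans ?_ (i.hom.map_smul r (y a)).symm
      exact (φ.hom.map_smul r a).trans (congrArg (fun z : Z => r • z) (hy a).symm)
    · ext x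
      exact hy x

section factor

variable (k : Type) [Field k] (C A : Type) [CommRing C] [CommRing A] [Algebra k C] [Algebra k A]

/-- If `C` has a factor `A` (projection `p`, nonunital section `q`), then the restriction of `A`
is a direct factor of `C` over the enveloping algebra of `C`, and
`Ext` from it is computed over the enveloping algebra of `A`. -/
lemma ext_factor (p : C →ₐ[k] A) (q : A →ₗ[k] C) (hpq : ∀ a, p (q a) = a)
    (hq : ∀ c a, q (p c * a) = c * q a) (n : ℕ) :
    ∃ (i : (ModuleCat.restrictScalars (Algebra.TensorProduct.map p p).toRingHom).obj
        (envModule k A) ⟶ envModule k C)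
      (π : envModule k C ⟶
        (ModuleCat.restrictScalars (Algebra.TensorProduct.map p p).toRingHom).obj (envModule k A)),
      (∀ a : A, i a = q a) ∧ (∀ c : C, π c = p c) ∧
      Nonempty (((Ext (C ⊗[k] C) (ModuleCat (C ⊗[k] C)) n).obj (Opposite.op
        ((ModuleCat.restrictScalars (Algebra.TensorProduct.map p p).toRingHom).obj
          (envModule k A)))).obj (envModule k C) ≃+ HH k A n) := by
  let f : C ⊗[k] C →+* A ⊗[k] A := (Algebra.TensorProduct.map p p).toRingHom
  let j : A ⊗[k] A →+ C ⊗[k] C := (TensorProduct.map q q).toAddMonoidHom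
  have hm : ∀ r : C ⊗[k] C, Algebra.TensorProduct.lmul' k (S := A) (f r) =
      p (Algebra.TensorProduct.lmul' k (S := C) r) := by
    intro r
    induction r with
    | zero => simp
    | tmul x y => simp [f]
    | add x y hx hy => simp only [map_add, hx, hy]
  have hf : ∀ x y, f (x ⊗ₜ y) = p x ⊗ₜ p y := fun x y => by simp [f]
  have hjt : ∀ x y, j (x ⊗ₜ y) = q x ⊗ₜ q y := fun x y => by simp [j]
  have hj1 : ∀ r s, j (f r * s) = r * j s := by
    intro r s
    induction r with
    | zero => simp
    | add x y hx hy => simp only [map_add, add_mul, hx, hy]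
    | tmul x y =>
      induction s with
      | zero => simp
      | add x y hx hy => simp only [map_add, mul_add, hx, hy]
      | tmul a b => simp only [hf, hjt, Algebra.TensorProduct.tmul_mul_tmul, hq]
  have hj2 : ∀ s, f (j s) = s := by
    intro s
    induction s with
    | zero => simp
    | add x y hx hy => simp only [map_add, hx, hy]
    | tmul a b => simp only [hf, hjt, hpq]
  let i : (ModuleCat.restrictScalars f).obj (envModule k A) ⟶ envModule k C :=
    ModuleCat.ofHom (X := (ModuleCat.restrictScalars f).obj (envModule k A))
      (Y := envModule k C)
      { toFun := fun a : A => q a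
        map_add' := fun a b : A => q.map_add a b
        map_smul' := fun r (a : A) => by
          change q (Algebra.TensorProduct.lmul' k (S := A) (f r) * a) =
            Algebra.TensorProduct.lmul' k (S := C) r * q a
          rw [hm, hq] }
  let π : envModule k C ⟶ (ModuleCat.restrictScalars f).obj (envModule k A) :=
    ModuleCat.ofHom (Y := (ModuleCat.restrictScalars f).obj (envModule k A))
      (X := envModule k C)
      { toFun := fun c : C => p c
        map_add' := fun a b : C => p.map_add a b
        map_smul' := fun r (c : C) => by
          change p (Algebra.TensorProduct.lmul' k (S := C) r * c) =
            Algebra.TensorProduct.lmul' k (S := A) (f r) * p c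
          rw [hm, map_mul] }
  refine ⟨i, π, fun _ => rfl, fun _ => rfl, ext_restrict f j hj1 hj2 _ _ _ i ?_ ?_ n⟩
  · intro (a : A) (b : A) (hab : q a = q b)
    exact (hpq a).symm.trans ((congrArg p hab).trans (hpq b))
  · intro (z : C)
    refine ⟨p z, ?_⟩
    change q (p z) = Algebra.TensorProduct.lmul' k (S := C) (j 1) * z
    rw [Algebra.TensorProduct.one_def, hjt, Algebra.TensorProduct.lmul'_apply_tmul]
    have h1 := hq (q 1) 1
    rw [hpq, one_mul] at h1
    rw [← h1, mul_comm, ← hq, mul_one]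

end factor

end HHProd

/-- The Hochschild cohomology of a product of commutative `k`-algebras is the product
of their Hochschild cohomologies, as abelian groups. -/
theorem hochschildCohomology_prod (k : Type) [Field k] (A B : Type)
    [CommRing A] [CommRing B] [Algebra k A] [Algebra k B] (n : ℕ) :
    Nonempty (HH k (A × B) n ≃+ HH k A n × HH k B n) := by
  obtain ⟨i₁, p₁, hi₁, hp₁, ⟨e₁⟩⟩ := HHProd.ext_factor k (A × B) A (AlgHom.fst k A B)
    (LinearMap.inl k A B) (fun _ => rfl) (fun c a => by ext <;> simp) n
  obtain ⟨i₂, p₂, hi₂, hp₂, ⟨e₂⟩⟩ := HHProd.ext_factor k (A × B) B (AlgHom.snd k A B)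
    (LinearMap.inr k A B) (fun _ => rfl) (fun c a => by ext <;> simp) n
  obtain ⟨e⟩ := HHProd.ext_biprod n (envModule k (A × B)) i₁ i₂ p₁ p₂
    (by ext (a : A)
        exact (congrArg p₁ (hi₁ a)).trans (hp₁ _))
    (by ext (a : B)
        exact (congrArg p₂ (hi₂ a)).trans (hp₂ _))
    (by ext (a : A)
        exact (congrArg p₂ (hi₁ a)).trans (hp₂ _))
    (by ext (a : B)
        exact (congrArg p₁ (hi₂ a)).trans (hp₁ _))
    (by
      ext (c : A × B)
      have h1 : i₁ (p₁ c) = (c.1, (0 : B)) := (congrArg i₁ (hp₁ c)).trans (hi₁ _)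
      have h2 : i₂ (p₂ c) = ((0 : A), c.2) := (congrArg i₂ (hp₂ c)).trans (hi₂ _)
      change i₁ (p₁ c) + i₂ (p₂ c) = c
      rw [h1, h2]
      change ((c.1 + 0, 0 + c.2) : A × B) = c
      simp)
  exact ⟨e.trans (e₁.prodCongr e₂)⟩
end
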